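/- arXiv:1904.04628 — 2 statements merged into one kernel-verified Lean document; each statement's English description precedes it below -/
import Mathlib

section
/- For every tournament r on Fin 4 with no directed 3-cycle, each face of the tetrahedron contains exactly one mixed edge of the tetrahedron. -/
/-- `e` is the long edge of the face `F` (joining the source of `F`
to the sink of `F`) for the edge orientation `r`. -/
def IsLongEdge (r : Fin 4 → Fin 4 → Prop) (F e : Finset (Fin 4)) : Prop :=
  ∃ s m t : Fin 4, F = {s, m, t} ∧ r s m ∧ r m t ∧ r s t ∧ e = {s, t}

/-- `e` is the bottom short edge of the face `F` (joining the source of `F`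
to the middle vertex of `F`) for the edge orientation `r`. -/
def IsBottomEdge (r : Fin 4 → Fin 4 → Prop) (F e : Finset (Fin 4)) : Prop :=
  ∃ s m t : Fin 4, F = {s, m, t} ∧ r s m ∧ r m t ∧ r s t ∧ e = {s, m}

/-- `e` is the top short edge of the face `F` (joining the middle vertex of
`F` to the sink of `F`) for the edge orientation `r`. -/
def IsTopEdge (r : Fin 4 → Fin 4 → Prop) (F e : Finset (Fin 4)) : Prop :=
  ∃ s m t : Fin 4, F = {s, m, t} ∧ r s m ∧ r m t ∧ r s t ∧ e = {m, t}

/-- `e` is the very long edge of the tetrahedron: an edge that is the long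
edge of both (i.e. every) faces of the tetrahedron containing it. -/
def IsVeryLongEdge (r : Fin 4 → Fin 4 → Prop) (e : Finset (Fin 4)) : Prop :=
  e.card = 2 ∧ ∀ F : Finset (Fin 4), F.card = 3 → e ⊆ F → IsLongEdge r F e

/-- `e` is a mixed edge of the tetrahedron: an edge that is the long edge of
exactly one of the two faces containing it. -/
def IsMixedEdge (r : Fin 4 → Fin 4 → Prop) (e : Finset (Fin 4)) : Prop :=
  e.card = 2 ∧ ∃! F : Finset (Fin 4), F.card = 3 ∧ e ⊆ F ∧ IsLongEdge r F e

/-- `e` is a compatibly short edge of the tetrahedron: an edge that is the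
bottom short edge of both faces containing it, or the top short edge of both
faces containing it. -/
def IsCompatiblyShortEdge (r : Fin 4 → Fin 4 → Prop) (e : Finset (Fin 4)) : Prop :=
  e.card = 2 ∧
    ((∀ F : Finset (Fin 4), F.card = 3 → e ⊆ F → IsBottomEdge r F e) ∨
     (∀ F : Finset (Fin 4), F.card = 3 → e ⊆ F → IsTopEdge r F e))

/-- An acyclic tournament on a finite type is the strict order of an enumeration of its vertices. -/
theorem exists_equiv_fin_of_acyclic_tournament {V : Type*} [Fintype V] {n : ℕ}
    (hcard : Fintype.card V = n) (r : V → V → Prop)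
    (hasym : ∀ a b, ¬(r a b ∧ r b a))
    (htotal : ∀ a b, a ≠ b → r a b ∨ r b a)
    (hacyclic : ¬ ∃ a b c, r a b ∧ r b c ∧ r c a) :
    ∃ σ : Fin n ≃ V, ∀ i j, r (σ i) (σ j) ↔ i < j := by
  classical
  have : IsStrictTotalOrder V r :=
    { irrefl := fun a h => hasym a a ⟨h, h⟩
      trans := fun a b c hab hbc => by
        by_cases hac : a = c
        · subst hac
          exact absurd ⟨hab, hbc⟩ (hasym a b)
        · exact (htotal a c hac).resolve_right fun hca => hacyclic ⟨a, b, c, hab, hbc, hca⟩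
      trichotomous := fun a b hab hba => by
        by_contra hne
        exact (htotal a b hne).elim hab hba }
  let := linearOrderOfSTO r
  let e := monoEquivOfFin V hcard
  exact ⟨e.toEquiv, fun i j => e.lt_iff_lt⟩

/-- Long edges are invariant under relabelling the vertices. -/
theorem isLongEdge_map_iff (r : Fin 4 → Fin 4 → Prop) (σ : Fin 4 ≃ Fin 4)
    (F e : Finset (Fin 4)) :
    IsLongEdge r (σ.finsetCongr F) (σ.finsetCongr e) ↔
      IsLongEdge (fun i j => r (σ i) (σ j)) F e := by
  have h3 (s m t : Fin 4) : ({σ s, σ m, σ t} : Finset (Fin 4)) = σ.finsetCongr {s, m, t} := by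
    simp [Finset.map_insert]
  have h2 (s t : Fin 4) : ({σ s, σ t} : Finset (Fin 4)) = σ.finsetCongr {s, t} := by
    simp [Finset.map_insert]
  refine σ.surjective.exists₃.trans ?_
  simp only [h3]
  simp only [h2, EmbeddingLike.apply_eq_iff_eq, IsLongEdge]

/-- Mixed edges are invariant under relabelling the vertices. -/
theorem isMixedEdge_map_iff (r : Fin 4 → Fin 4 → Prop) (σ : Fin 4 ≃ Fin 4)
    (e : Finset (Fin 4)) :
    IsMixedEdge r (σ.finsetCongr e) ↔ IsMixedEdge (fun i j => r (σ i) (σ j)) e := by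
  unfold IsMixedEdge
  refine and_congr (by simp) ?_
  rw [← σ.finsetCongr.existsUnique_congr_right]
  simp only [isLongEdge_map_iff]
  simp

set_option synthInstance.maxSize 1000 in
/-- The mixed edges of the standard ordering `0 < 1 < 2 < 3` are `{0, 2}` and `{1, 3}`. -/
theorem isMixedEdge_lt_iff (e : Finset (Fin 4)) :
    IsMixedEdge (· < ·) e ↔ e = {0, 2} ∨ e = {1, 3} := by
  have hlong : ∀ F e : Finset (Fin 4), IsLongEdge (· < ·) F e ↔
      (F = {0, 1, 2} ∧ e = {0, 2}) ∨ (F = {0, 1, 3} ∧ e = {0, 3}) ∨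
      (F = {0, 2, 3} ∧ e = {0, 3}) ∨ (F = {1, 2, 3} ∧ e = {1, 3}) := by
    intro F e
    constructor
    · rintro ⟨s, m, t, rfl, hsm, hmt, -, rfl⟩
      revert s m t
      decide
    · rintro (⟨rfl, rfl⟩ | ⟨rfl, rfl⟩ | ⟨rfl, rfl⟩ | ⟨rfl, rfl⟩)
      · exact ⟨0, 1, 2, by decide⟩
      · exact ⟨0, 1, 3, by decide⟩
      · exact ⟨0, 2, 3, by decide⟩
      · exact ⟨1, 2, 3, by decide⟩
  simp only [IsMixedEdge, hlong]
  revert e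
  unfold ExistsUnique
  decide

/-- For every acyclic edge orientation of the tetrahedron, each face contains
exactly one mixed edge of the tetrahedron. -/
theorem each_face_one_mixed_edge (r : Fin 4 → Fin 4 → Prop)
    (hasym : ∀ a b, ¬(r a b ∧ r b a))
    (htotal : ∀ a b, a ≠ b → r a b ∨ r b a)
    (hacyclic : ¬ ∃ a b c, r a b ∧ r b c ∧ r c a) :
    ∀ F : Finset (Fin 4), F.card = 3 →
      ∃! e : Finset (Fin 4), e ⊆ F ∧ IsMixedEdge r e := by
  obtain ⟨σ, hσ⟩ := exists_equiv_fin_of_acyclic_tournament (Fintype.card_fin 4) r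
    hasym htotal hacyclic
  have hr : (fun i j => r (σ i) (σ j)) = (· < ·) := by
    ext i j
    exact hσ i j
  rw [← σ.finsetCongr.forall_congr_right]
  intro F hF
  rw [← σ.finsetCongr.existsUnique_congr_right]
  simp only [isMixedEdge_map_iff, hr, isMixedEdge_lt_iff]
  simp only [Equiv.finsetCongr_apply, Finset.card_map, Finset.map_subset_map] at hF ⊢
  revert F
  unfold ExistsUnique
  decide
end

section
/- For every tournament r on Fin 4 with no directed 3-cycle, each face of the tetrahedron contains exactly one compatibly short edge of the tetrahedron. -/
/-- A strict total order on a type with `n` elements is isomorphic to `Fin n`. -/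
theorem exists_equiv_fin_rel_iff_lt {V : Type*} [Fintype V] {n : ℕ} (hcard : Fintype.card V = n)
    (r : V → V → Prop) [IsStrictTotalOrder V r] :
    ∃ σ : Fin n ≃ V, ∀ i j, r (σ i) (σ j) ↔ i < j := by
  classical
  let _ : LinearOrder V := linearOrderOfSTO r
  exact ⟨(Fintype.orderIsoFinOfCardEq V hcard).toEquiv,
    fun i j => (Fintype.orderIsoFinOfCardEq V hcard).lt_iff_lt⟩

section Relabel

variable {r q : Fin 4 → Fin 4 → Prop} {σ : Equiv.Perm (Fin 4)}

theorem isBottomEdge_map_iff (h : ∀ i j, r (σ i) (σ j) ↔ q i j) (F e : Finset (Fin 4)) :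
    IsBottomEdge r (F.map σ.toEmbedding) (e.map σ.toEmbedding) ↔ IsBottomEdge q F e := by
  rw [IsBottomEdge, σ.surjective.exists₃]
  simp only [h]
  simp only [← Equiv.coe_toEmbedding σ, ← Finset.map_singleton, ← Finset.map_insert,
    Finset.map_inj, IsBottomEdge]

theorem isTopEdge_map_iff (h : ∀ i j, r (σ i) (σ j) ↔ q i j) (F e : Finset (Fin 4)) :
    IsTopEdge r (F.map σ.toEmbedding) (e.map σ.toEmbedding) ↔ IsTopEdge q F e := by
  rw [IsTopEdge, σ.surjective.exists₃]
  simp only [h]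
  simp only [← Equiv.coe_toEmbedding σ, ← Finset.map_singleton, ← Finset.map_insert,
    Finset.map_inj, IsTopEdge]

theorem isCompatiblyShortEdge_map_iff (h : ∀ i j, r (σ i) (σ j) ↔ q i j) (e : Finset (Fin 4)) :
    IsCompatiblyShortEdge r (e.map σ.toEmbedding) ↔ IsCompatiblyShortEdge q e := by
  unfold IsCompatiblyShortEdge
  rw [Finset.card_map]
  refine and_congr_right' (or_congr ?_ ?_) <;> rw [σ.finsetCongr.surjective.forall] <;>
    simp only [Equiv.finsetCongr_apply, Finset.card_map, Finset.map_subset_map,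
      isBottomEdge_map_iff h, isTopEdge_map_iff h]

end Relabel

set_option synthInstance.maxSize 2000 in
theorem isCompatiblyShortEdge_lt_iff (e : Finset (Fin 4)) :
    IsCompatiblyShortEdge (· < ·) e ↔ e = {0, 1} ∨ e = {2, 3} := by
  unfold IsCompatiblyShortEdge IsBottomEdge IsTopEdge
  beta_reduce
  revert e
  decide

/-- For every acyclic edge orientation of the tetrahedron, each face contains
exactly one compatibly short edge of the tetrahedron. -/
theorem each_face_one_compatibly_short_edge (r : Fin 4 → Fin 4 → Prop)
    (hasym : ∀ a b, ¬(r a b ∧ r b a))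
    (htotal : ∀ a b, a ≠ b → r a b ∨ r b a)
    (hacyclic : ¬ ∃ a b c, r a b ∧ r b c ∧ r c a) :
    ∀ F : Finset (Fin 4), F.card = 3 →
      ∃! e : Finset (Fin 4), e ⊆ F ∧ IsCompatiblyShortEdge r e := by
  have hirrefl (a : Fin 4) : ¬ r a a := fun h => hasym a a ⟨h, h⟩
  have : IsStrictTotalOrder (Fin 4) r :=
    { irrefl := hirrefl
      trans := fun a b c hab hbc => by
        have hac : a ≠ c := by
          rintro rfl
          exact hasym a b ⟨hab, hbc⟩
        exact (htotal a c hac).resolve_right fun hca => hacyclic ⟨a, b, c, hab, hbc, hca⟩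
      trichotomous := fun a b hab hba => by
        by_contra hne
        exact (htotal a b hne).elim hab hba }
  obtain ⟨σ, hσ⟩ := exists_equiv_fin_rel_iff_lt (Fintype.card_fin 4) r
  rw [σ.finsetCongr.surjective.forall]
  intro F hF
  rw [σ.finsetCongr.bijective.existsUnique_iff]
  simp only [Equiv.finsetCongr_apply, Finset.card_map, Finset.map_subset_map,
    isCompatiblyShortEdge_map_iff hσ, isCompatiblyShortEdge_lt_iff] at hF ⊢
  unfold ExistsUnique
  revert F
  decide
end
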